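/- arXiv:2512.03916 — 5 statements merged into one kernel-verified Lean document; each statement's English description precedes it below -/
import Mathlib

section
/- Let D be a totally ordered idempotent commutative dioid and A a commutative semiring. Then (D Δ A, ⊕, ⊗, (∞_D, 0_A), (0_D, 1_A)) is a commutative semiring. Concretely: D Δ A is closed under ⊕ and ⊗; ⊕ is commutative and associative on D Δ A and has neutral element (∞_D, 0_A); ⊗ is commutative and associative on D Δ A and has neutral element (0_D, 1_A); (∞_D, 0_A) is absorbing for ⊗ on D Δ A; ⊗ distributes over ⊕ on D Δ A; and (∞_D, 0_A) ≠ (0_D, 1_A). -/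
open scoped Classical

/-- The canonical order of a dioid whose addition (written `min` in the paper) is `+`:
`d1 ≤_D d2` iff there exists `c` with `min(d2, c) = d1`. -/
def dioidLe {D : Type*} [CommSemiring D] (d1 d2 : D) : Prop := ∃ c, d2 + c = d1

/-- `d1 <_D d2` means `d1 ≤_D d2` and `d1 ≠ d2`. -/
def dioidLt {D : Type*} [CommSemiring D] (d1 d2 : D) : Prop := dioidLe d1 d2 ∧ d1 ≠ d2

/-- A multiplicatively regular element of a commutative semiring. -/
def IsMultReg {A : Type*} [CommSemiring A] (a : A) : Prop :=
  a ≠ 0 ∧ ∀ b c : A, a * b = a * c → b = c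

/-- The underlying set of the Δ-product `D Δ A`. -/
def deltaSet (D A : Type*) [CommSemiring D] [CommSemiring A] : Set (D × A) :=
  {p | IsMultReg p.1 ∨ p.2 = 0}

/-- The addition `⊕` of the Δ-product.  Note that the dioid addition `min` of `D` is `+`,
its multiplication `+_D` is `*`, `∞_D` is `0` and `0_D` is `1`. -/
noncomputable def deltaAdd {D A : Type*} [CommSemiring D] [CommSemiring A]
    (p q : D × A) : D × A :=
  (p.1 + q.1, if p.1 = q.1 then p.2 + q.2 else if dioidLe p.1 q.1 then p.2 else q.2)

/-- The multiplication `⊗` of the Δ-product. -/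
def deltaMul {D A : Type*} [CommSemiring D] [CommSemiring A] (p q : D × A) : D × A :=
  (p.1 * q.1, p.2 * q.2)

theorem dioidLe_iff_add_eq {D : Type*} [CommSemiring D] (hidem : ∀ d : D, d + d = d) (a b : D) :
    dioidLe a b ↔ a + b = a := by
  refine ⟨?_, fun h => ⟨a, by rw [add_comm, h]⟩⟩
  rintro ⟨c, rfl⟩
  rw [add_right_comm, hidem]

theorem IsMultReg.mul {D : Type*} [CommSemiring D] {a b : D} (ha : IsMultReg a)
    (hb : IsMultReg b) : IsMultReg (a * b) := by
  refine ⟨fun h => hb.1 (ha.2 b 0 (by rw [h, mul_zero])), fun x y h => ?_⟩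
  rw [mul_assoc, mul_assoc] at h
  exact hb.2 _ _ (ha.2 _ _ h)

theorem isMultReg_one {D : Type*} [CommSemiring D] (h : (0 : D) ≠ 1) : IsMultReg (1 : D) :=
  ⟨h.symm, fun b c hbc => by simpa using hbc⟩

theorem deltaAdd_of_fst_eq {D A : Type*} [CommSemiring D] [CommSemiring A]
    (hidem : ∀ d : D, d + d = d) (d : D) (a b : A) :
    deltaAdd (d, a) (d, b) = (d, a + b) := by
  simp [deltaAdd, hidem]

theorem deltaAdd_of_le {D A : Type*} [CommSemiring D] [CommSemiring A]
    (hidem : ∀ d : D, d + d = d) {d e : D} (h : d + e = d) (hne : d ≠ e) (a b : A) :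
    deltaAdd (d, a) (e, b) = (d, a) := by
  simp [deltaAdd, dioidLe_iff_add_eq hidem, h, hne]

theorem deltaAdd_of_ge {D A : Type*} [CommSemiring D] [CommSemiring A]
    (hidem : ∀ d : D, d + d = d) {d e : D} (h : d + e = e) (hne : d ≠ e) (a b : A) :
    deltaAdd (d, a) (e, b) = (e, b) := by
  simp [deltaAdd, dioidLe_iff_add_eq hidem, h, hne, hne.symm]

theorem add_eq_left_or_right {D : Type*} [CommSemiring D] (hidem : ∀ d : D, d + d = d)
    (htot : ∀ d1 d2 : D, dioidLe d1 d2 ∨ dioidLe d2 d1) (d e : D) :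
    d + e = d ∨ d + e = e := by
  simpa only [dioidLe_iff_add_eq hidem, add_comm e d] using htot d e

theorem deltaAdd_comm {D A : Type*} [CommSemiring D] [CommSemiring A]
    (hidem : ∀ d : D, d + d = d)
    (htot : ∀ d1 d2 : D, dioidLe d1 d2 ∨ dioidLe d2 d1) (p q : D × A) :
    deltaAdd p q = deltaAdd q p := by
  obtain ⟨d, a⟩ := p
  obtain ⟨e, b⟩ := q
  have := add_eq_left_or_right hidem htot d e
  have hcomm := add_comm d e
  have hcomm' := add_comm a b
  simp only [deltaAdd, dioidLe_iff_add_eq hidem]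
  grind -ring -linarith

theorem deltaAdd_assoc {D A : Type*} [CommSemiring D] [CommSemiring A]
    (hidem : ∀ d : D, d + d = d)
    (htot : ∀ d1 d2 : D, dioidLe d1 d2 ∨ dioidLe d2 d1) (p q r : D × A) :
    deltaAdd (deltaAdd p q) r = deltaAdd p (deltaAdd q r) := by
  obtain ⟨d, a⟩ := p
  obtain ⟨e, b⟩ := q
  obtain ⟨f, c⟩ := r
  have hde := add_eq_left_or_right hidem htot d e
  have hef := add_eq_left_or_right hidem htot e f
  have hdf := add_eq_left_or_right hidem htot d f
  have hassoc := add_assoc d e f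
  have hassoc' := add_assoc a b c
  simp only [deltaAdd, dioidLe_iff_add_eq hidem]
  grind -ring -linarith

theorem deltaAdd_mem {D A : Type*} [CommSemiring D] [CommSemiring A]
    (hidem : ∀ d : D, d + d = d)
    (htot : ∀ d1 d2 : D, dioidLe d1 d2 ∨ dioidLe d2 d1) {p q : D × A}
    (hp : p ∈ deltaSet D A) (hq : q ∈ deltaSet D A) : deltaAdd p q ∈ deltaSet D A := by
  obtain ⟨d, a⟩ := p
  obtain ⟨e, b⟩ := q
  by_cases hne : d = e
  · subst hne
    rw [deltaAdd_of_fst_eq hidem]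
    rcases hp with hp | hp
    · exact .inl hp
    · exact hq.imp_right fun hq => by simp_all
  · rcases add_eq_left_or_right hidem htot d e with h | h
    · rwa [deltaAdd_of_le hidem h hne]
    · rwa [deltaAdd_of_ge hidem h hne]

theorem deltaMul_mem {D A : Type*} [CommSemiring D] [CommSemiring A] {p q : D × A}
    (hp : p ∈ deltaSet D A) (hq : q ∈ deltaSet D A) : deltaMul p q ∈ deltaSet D A := by
  rcases hp with hp | hp
  · rcases hq with hq | hq
    · exact .inl (hp.mul hq)
    · exact .inr (by simp [deltaMul, hq])
  · exact .inr (by simp [deltaMul, hp])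

theorem deltaAdd_zero {D A : Type*} [CommSemiring D] [CommSemiring A]
    (hidem : ∀ d : D, d + d = d) (p : D × A) : deltaAdd p (0, 0) = p := by
  simp [deltaAdd, dioidLe_iff_add_eq hidem]

theorem deltaMul_deltaAdd {D A : Type*} [CommSemiring D] [CommSemiring A]
    (hidem : ∀ d : D, d + d = d)
    (htot : ∀ d1 d2 : D, dioidLe d1 d2 ∨ dioidLe d2 d1) {p : D × A}
    (hp : p ∈ deltaSet D A) (q r : D × A) :
    deltaMul p (deltaAdd q r) = deltaAdd (deltaMul p q) (deltaMul p r) := by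
  obtain ⟨d, a⟩ := p
  obtain ⟨e, b⟩ := q
  obtain ⟨f, c⟩ := r
  rcases hp with ⟨-, hreg⟩ | rfl
  · by_cases hne : e = f
    · subst hne
      simp only [deltaMul, deltaAdd_of_fst_eq hidem, mul_add]
    · have hne' : d * e ≠ d * f := fun h => hne (hreg _ _ h)
      rcases add_eq_left_or_right hidem htot e f with h | h
      · simp only [deltaMul, deltaAdd_of_le hidem h hne,
          deltaAdd_of_le hidem (by rw [← mul_add, h]) hne']
      · simp only [deltaMul, deltaAdd_of_ge hidem h hne,
          deltaAdd_of_ge hidem (by rw [← mul_add, h]) hne']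
  · simp [deltaMul, deltaAdd, mul_add]

/-- If `D` is a totally ordered idempotent commutative dioid and `A` a
commutative semiring (both with `0 ≠ 1`), then `(D Δ A, ⊕, ⊗, (∞_D, 0_A), (0_D, 1_A))` is a
commutative semiring. -/
theorem deltaProduct_commSemiring
    {D A : Type*} [CommSemiring D] [CommSemiring A]
    (hidem : ∀ d : D, d + d = d)
    (htot : ∀ d1 d2 : D, dioidLe d1 d2 ∨ dioidLe d2 d1)
    (hD01 : (0 : D) ≠ 1) (hA01 : (0 : A) ≠ 1) :
    -- closure under ⊕ and ⊗
    (∀ p ∈ deltaSet D A, ∀ q ∈ deltaSet D A, deltaAdd p q ∈ deltaSet D A) ∧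
    (∀ p ∈ deltaSet D A, ∀ q ∈ deltaSet D A, deltaMul p q ∈ deltaSet D A) ∧
    -- ⊕ commutative and associative, with neutral element (∞_D, 0_A)
    (∀ p ∈ deltaSet D A, ∀ q ∈ deltaSet D A, deltaAdd p q = deltaAdd q p) ∧
    (∀ p ∈ deltaSet D A, ∀ q ∈ deltaSet D A, ∀ r ∈ deltaSet D A,
      deltaAdd (deltaAdd p q) r = deltaAdd p (deltaAdd q r)) ∧
    (((0 : D), (0 : A)) ∈ deltaSet D A ∧
      ∀ p ∈ deltaSet D A, deltaAdd p ((0 : D), (0 : A)) = p) ∧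
    -- ⊗ commutative and associative, with neutral element (0_D, 1_A)
    (∀ p ∈ deltaSet D A, ∀ q ∈ deltaSet D A, deltaMul p q = deltaMul q p) ∧
    (∀ p ∈ deltaSet D A, ∀ q ∈ deltaSet D A, ∀ r ∈ deltaSet D A,
      deltaMul (deltaMul p q) r = deltaMul p (deltaMul q r)) ∧
    (((1 : D), (1 : A)) ∈ deltaSet D A ∧
      ∀ p ∈ deltaSet D A, deltaMul p ((1 : D), (1 : A)) = p) ∧
    -- (∞_D, 0_A) is absorbing for ⊗
    (∀ p ∈ deltaSet D A, deltaMul p ((0 : D), (0 : A)) = ((0 : D), (0 : A))) ∧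
    -- ⊗ distributes over ⊕
    (∀ p ∈ deltaSet D A, ∀ q ∈ deltaSet D A, ∀ r ∈ deltaSet D A,
      deltaMul p (deltaAdd q r) = deltaAdd (deltaMul p q) (deltaMul p r)) ∧
    -- zero is distinct from one
    (((0 : D), (0 : A)) ≠ ((1 : D), (1 : A))) := by
  refine ⟨fun p hp q hq => deltaAdd_mem hidem htot hp hq, fun p hp q hq => deltaMul_mem hp hq,
    fun p _ q _ => deltaAdd_comm hidem htot p q,
    fun p _ q _ r _ => deltaAdd_assoc hidem htot p q r,
    ⟨.inr rfl, fun p _ => deltaAdd_zero hidem p⟩,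
    fun p _ q _ => Prod.ext (mul_comm _ _) (mul_comm _ _),
    fun p _ q _ r _ => Prod.ext (mul_assoc _ _ _) (mul_assoc _ _ _),
    ⟨.inl (isMultReg_one hD01), fun p _ => Prod.ext (mul_one _) (mul_one _)⟩,
    fun p _ => Prod.ext (mul_zero _) (mul_zero _),
    fun p hp q _ r _ => deltaMul_deltaAdd hidem htot hp q r,
    fun h => hD01 (congrArg Prod.fst h)⟩
end

section
/- Let D be a totally ordered idempotent commutative dioid, A a commutative semiring, X a type with decidable equality, and w : X → D and μ : X → A. For a finite set ℱ ⊆ X, define W(ℱ) ∈ D as the sum in the dioid D (i.e., the min) of w(f) over f ∈ ℱ (so W(∅) = ∞_D), define argmin_w(ℱ) := {f ∈ ℱ : w(f) = W(ℱ)}, and define (w Δ μ)(ℱ) := W(ℱ) Δ (∑_{f ∈ argmin_w(ℱ)} μ(f)) ∈ D × A, where the last sum is taken in A. Then w Δ μ is additive: for all finite sets ℱ1, ℱ2 ⊆ X with ℱ1 ∩ ℱ2 = ∅, one has (w Δ μ)(ℱ1 ∪ ℱ2) = (w Δ μ)(ℱ1) ⊕ (w Δ μ)(ℱ2). -/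
open scoped Classical

/-- `d Δ a` is `(d, a)` if `d` is multiplicatively regular and `(d, 0_A)` otherwise. -/
noncomputable def deltaPair {D A : Type*} [CommSemiring D] [CommSemiring A]
    (d : D) (a : A) : D × A :=
  if IsMultReg d then (d, a) else (d, 0)

/-- `W(ℱ)`: the sum in the dioid `D` (i.e. the `min`) of `w f` over `f ∈ ℱ`;
the empty sum is `∞_D = 0`. -/
noncomputable def minWeight {X D : Type*} [CommSemiring D] (w : X → D) (F : Finset X) : D :=
  ∑ f ∈ F, w f

/-- `argmin_w(ℱ) = {f ∈ ℱ : w(f) = W(ℱ)}`. -/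
noncomputable def argminSet {X D : Type*} [CommSemiring D] (w : X → D) (F : Finset X) :
    Finset X :=
  F.filter (fun f => w f = minWeight w F)

/-- `(w Δ μ)(ℱ) := W(ℱ) Δ (∑_{f ∈ argmin_w(ℱ)} μ(f))`. -/
noncomputable def wDeltaMu {X D A : Type*} [CommSemiring D] [CommSemiring A]
    (w : X → D) (μ : X → A) (F : Finset X) : D × A :=
  deltaPair (minWeight w F) (∑ f ∈ argminSet w F, μ f)

theorem add_eq_left_of_dioidLe {D : Type*} [CommSemiring D] (hidem : ∀ d : D, d + d = d)
    {d1 d2 : D} (h : dioidLe d1 d2) : d1 + d2 = d1 := by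
  obtain ⟨c, rfl⟩ := h
  rw [add_right_comm, hidem]

theorem minWeight_union {X D : Type*} [DecidableEq X] [CommSemiring D] (w : X → D)
    {F1 F2 : Finset X} (h : Disjoint F1 F2) :
    minWeight w (F1 ∪ F2) = minWeight w F1 + minWeight w F2 :=
  Finset.sum_union h

theorem minWeight_add_of_mem {X D : Type*} [CommSemiring D] (hidem : ∀ d : D, d + d = d)
    (w : X → D) {F : Finset X} {f : X} (hf : f ∈ F) :
    minWeight w F + w f = minWeight w F := by
  unfold minWeight
  rw [← Finset.add_sum_erase F w hf, add_right_comm, hidem]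

/-- No element of `F` has weight strictly below the minimum weight of `F`. -/
theorem filter_weight_eq_empty {X D : Type*} [CommSemiring D] (hidem : ∀ d : D, d + d = d)
    (w : X → D) {F : Finset X} {d : D} (hle : d + minWeight w F = d) (hne : d ≠ minWeight w F) :
    F.filter (fun f => w f = d) = ∅ := by
  refine Finset.filter_eq_empty_iff.2 fun f hf hfd => hne ?_
  rw [← hle, ← hfd, add_comm, minWeight_add_of_mem hidem w hf]

theorem wDeltaMu_union_of_lt {X D A : Type*} [DecidableEq X] [CommSemiring D] [CommSemiring A]
    (hidem : ∀ d : D, d + d = d) (w : X → D) (μ : X → A) {F1 F2 : Finset X}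
    (h : Disjoint F1 F2) (hle : minWeight w F1 + minWeight w F2 = minWeight w F1)
    (hne : minWeight w F1 ≠ minWeight w F2) :
    wDeltaMu w μ (F1 ∪ F2) = wDeltaMu w μ F1 := by
  unfold wDeltaMu argminSet
  rw [minWeight_union w h, hle, Finset.filter_union, filter_weight_eq_empty hidem w hle hne,
    Finset.union_empty]

theorem wDeltaMu_union_of_eq {X D A : Type*} [DecidableEq X] [CommSemiring D] [CommSemiring A]
    (hidem : ∀ d : D, d + d = d) (w : X → D) (μ : X → A) {F1 F2 : Finset X}
    (h : Disjoint F1 F2) (heq : minWeight w F1 = minWeight w F2) :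
    wDeltaMu w μ (F1 ∪ F2) =
      (minWeight w F1, (wDeltaMu w μ F1).2 + (wDeltaMu w μ F2).2) := by
  unfold wDeltaMu argminSet deltaPair
  rw [minWeight_union w h, ← heq, hidem, Finset.filter_union,
    Finset.sum_union (Finset.disjoint_filter_filter h)]
  split_ifs <;> simp

theorem wDeltaMu_fst {X D A : Type*} [CommSemiring D] [CommSemiring A]
    (w : X → D) (μ : X → A) (F : Finset X) : (wDeltaMu w μ F).1 = minWeight w F := by
  unfold wDeltaMu deltaPair
  split_ifs <;> rfl

/-- `w Δ μ` is additive: for disjoint finite sets `ℱ1`, `ℱ2`,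
`(w Δ μ)(ℱ1 ⊎ ℱ2) = (w Δ μ)(ℱ1) ⊕ (w Δ μ)(ℱ2)`. -/
theorem wDeltaMu_additive
    {X D A : Type*} [DecidableEq X] [CommSemiring D] [CommSemiring A]
    (hidem : ∀ d : D, d + d = d)
    (htot : ∀ d1 d2 : D, dioidLe d1 d2 ∨ dioidLe d2 d1)
    (w : X → D) (μ : X → A) :
    ∀ F1 F2 : Finset X, Disjoint F1 F2 →
      wDeltaMu w μ (F1 ∪ F2) = deltaAdd (wDeltaMu w μ F1) (wDeltaMu w μ F2) := by
  intro F1 F2 h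
  unfold deltaAdd
  simp only [wDeltaMu_fst]
  split_ifs with heq hle
  · rw [wDeltaMu_union_of_eq hidem w μ h heq, ← heq, hidem]
  · have hadd := add_eq_left_of_dioidLe hidem hle
    rw [wDeltaMu_union_of_lt hidem w μ h hadd heq, hadd, ← wDeltaMu_fst w μ F1]
  · have hadd := add_eq_left_of_dioidLe hidem ((htot _ _).resolve_left hle)
    rw [Finset.union_comm, wDeltaMu_union_of_lt hidem w μ h.symm hadd (Ne.symm heq), add_comm,
      hadd, ← wDeltaMu_fst w μ F2]
end

section
/- Let D be a totally ordered idempotent commutative dioid, A a commutative semiring, S a type with decidable equality, T a type, and W : S → T → D, M : S → T → A. Then for all disjoint finite sets S1, S2 ⊆ S and every f : S → T, (∏_{s ∈ S1 ∪ S2} W s (f s)) Δ (∏_{s ∈ S1 ∪ S2} M s (f s)) = ((∏_{s ∈ S1} W s (f s)) Δ (∏_{s ∈ S1} M s (f s))) ⊗ ((∏_{s ∈ S2} W s (f s)) Δ (∏_{s ∈ S2} M s (f s))), where products in D are taken with respect to the multiplication +_D (with empty product 0_D) and products in A with respect to the multiplication ·_A (with empty product 1_A). -/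
open scoped Classical

/-- A product is multiplicatively regular iff both factors are. -/
theorem isMultReg_mul_iff {D : Type*} [CommSemiring D] {x y : D} :
    IsMultReg (x * y) ↔ IsMultReg x ∧ IsMultReg y := by
  constructor
  · rintro ⟨h0, hc⟩
    refine ⟨⟨left_ne_zero_of_mul h0, fun b c h => hc b c ?_⟩,
      ⟨right_ne_zero_of_mul h0, fun b c h => hc b c ?_⟩⟩
    · rw [mul_right_comm, h, mul_right_comm]
    · rw [mul_assoc, h, mul_assoc]
  · rintro ⟨hx, hy⟩
    refine ⟨fun h => hy.1 (hx.2 y 0 (by rw [h, mul_zero])), fun b c h => ?_⟩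
    exact hy.2 b c (hx.2 _ _ (by rwa [← mul_assoc, ← mul_assoc]))

/-- The operation `Δ` is multiplicative. -/
theorem deltaPair_mul {D A : Type*} [CommSemiring D] [CommSemiring A] (x y : D) (a b : A) :
    deltaPair (x * y) (a * b) = deltaMul (deltaPair x a) (deltaPair y b) := by
  by_cases hx : IsMultReg x <;> by_cases hy : IsMultReg y <;>
    simp [deltaPair, deltaMul, isMultReg_mul_iff, hx, hy]

/-- For disjoint finite sets `S1`, `S2` and any `f : S → T`,
`(∏_{S1∪S2} W s (f s)) Δ (∏_{S1∪S2} M s (f s))` is the `⊗`-product of the corresponding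
pairs over `S1` and over `S2`.  Products in `D` are taken with respect to the dioid
multiplication `+_D` (empty product `0_D = 1`), and products in `A` with respect to `·_A`. -/
theorem deltaPair_prod_union
    {S T D A : Type*} [DecidableEq S] [CommSemiring D] [CommSemiring A]
    (hidem : ∀ d : D, d + d = d)
    (htot : ∀ d1 d2 : D, dioidLe d1 d2 ∨ dioidLe d2 d1)
    (W : S → T → D) (M : S → T → A) :
    ∀ S1 S2 : Finset S, Disjoint S1 S2 → ∀ f : S → T,
      deltaPair (∏ s ∈ S1 ∪ S2, W s (f s)) (∏ s ∈ S1 ∪ S2, M s (f s)) =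
        deltaMul
          (deltaPair (∏ s ∈ S1, W s (f s)) (∏ s ∈ S1, M s (f s)))
          (deltaPair (∏ s ∈ S2, W s (f s)) (∏ s ∈ S2, M s (f s))) := by
  intro S1 S2 h f
  rw [Finset.prod_union h, Finset.prod_union h, deltaPair_mul]
end

section
/- Let S and T be types with decidable equality, A a commutative semiring, and M : S → T → A. Then for every legal join/union expression E over (S,T) (i.e., [E] ≠ FAIL), the semiring evaluation of E computes the measure of its semantics: eval_M(E) = ∑_{g ∈ [E]} ∏_{(s,t) ∈ g} M s t, where the sum ranges over the finite set of graphs [E] and the product over the pairs of the graph g. -/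
/-- Join/union expressions over `(S, T)`:
`E ::= Empty | Unit | (s ↦ t) | E₁ ⊎ E₂ | E₁ ⋈ E₂`. -/
inductive JUExpr (S T : Type*) where
  | empty : JUExpr S T
  | unit : JUExpr S T
  | single : S → T → JUExpr S T
  | union : JUExpr S T → JUExpr S T → JUExpr S T
  | join : JUExpr S T → JUExpr S T → JUExpr S T

variable {S T : Type*} [DecidableEq S] [DecidableEq T]

/-- The domain of a join/union expression. -/
def JUExpr.dom : JUExpr S T → Finset S
  | .empty => ∅
  | .unit => ∅
  | .single s _ => {s}
  | .union e1 e2 => e1.dom ∪ e2.dom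
  | .join e1 e2 => e1.dom ∪ e2.dom

/-- The semantics of a join/union expression: `none` is FAIL, otherwise a finite set of
graphs of partial functions (finite sets of pairs in `S × T`). -/
def JUExpr.sem : JUExpr S T → Option (Finset (Finset (S × T)))
  | .empty => some ∅
  | .unit => some {∅}
  | .single s t => some {{(s, t)}}
  | .union e1 e2 =>
    match e1.sem, e2.sem with
    | some F1, some F2 =>
      if F2 = ∅ then some F1
      else if F1 = ∅ then some F2
      else if e1.dom ≠ e2.dom then none
      else if F1 ∩ F2 ≠ ∅ then none
      else some (F1 ∪ F2)
    | _, _ => none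
  | .join e1 e2 =>
    match e1.sem, e2.sem with
    | some F1, some F2 =>
      if ¬ Disjoint e1.dom e2.dom then none
      else some ((F1 ×ˢ F2).image (fun p => p.1 ∪ p.2))
    | _, _ => none

/-- The evaluation of a join/union expression in a commutative semiring, given a matrix
`M : S → T → A`. -/
def JUExpr.eval {A : Type*} [CommSemiring A] (M : S → T → A) : JUExpr S T → A
  | .empty => 0
  | .unit => 1
  | .single s t => M s t
  | .union e1 e2 => e1.eval M + e2.eval M
  | .join e1 e2 => e1.eval M * e2.eval M

theorem JUExpr.sem_union_eq_some {e1 e2 : JUExpr S T} {F : Finset (Finset (S × T))}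
    (h : (e1.union e2).sem = some F) :
    ∃ F1 F2, e1.sem = some F1 ∧ e2.sem = some F2 ∧ Disjoint F1 F2 ∧ F = F1 ∪ F2 := by
  rw [JUExpr.sem] at h
  split at h
  · rename_i F1 F2 h1 h2
    refine ⟨F1, F2, h1, h2, ?_⟩
    rw [Finset.disjoint_iff_inter_eq_empty]
    split_ifs at h <;> simp_all
  · simp at h

theorem JUExpr.sem_join_eq_some {e1 e2 : JUExpr S T} {F : Finset (Finset (S × T))}
    (h : (e1.join e2).sem = some F) :
    ∃ F1 F2, e1.sem = some F1 ∧ e2.sem = some F2 ∧ Disjoint e1.dom e2.dom ∧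
      F = (F1 ×ˢ F2).image (fun p => p.1 ∪ p.2) := by
  rw [JUExpr.sem] at h
  split at h
  · rename_i F1 F2 h1 h2
    refine ⟨F1, F2, h1, h2, ?_⟩
    split_ifs at h
    simp_all
  · simp at h

theorem JUExpr.fst_mem_dom_of_mem_sem {E : JUExpr S T} {F : Finset (Finset (S × T))}
    (h : E.sem = some F) {g : Finset (S × T)} (hg : g ∈ F) {p : S × T} (hp : p ∈ g) :
    p.1 ∈ E.dom := by
  induction E generalizing F g with
  | empty => simp_all [JUExpr.sem, eq_comm]
  | unit =>
    simp only [JUExpr.sem, Option.some.injEq] at h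
    subst h
    simp_all
  | single s t =>
    simp only [JUExpr.sem, Option.some.injEq] at h
    subst h
    simp_all [JUExpr.dom]
  | union e1 e2 ih1 ih2 =>
    obtain ⟨F1, F2, h1, h2, -, rfl⟩ := JUExpr.sem_union_eq_some h
    rw [JUExpr.dom, Finset.mem_union]
    exact (Finset.mem_union.1 hg).imp (ih1 h1 · hp) (ih2 h2 · hp)
  | join e1 e2 ih1 ih2 =>
    obtain ⟨F1, F2, h1, h2, -, rfl⟩ := JUExpr.sem_join_eq_some h
    obtain ⟨⟨g1, g2⟩, hq, rfl⟩ := Finset.mem_image.1 hg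
    rw [Finset.mem_product] at hq
    rw [JUExpr.dom, Finset.mem_union]
    exact (Finset.mem_union.1 hp).imp (ih1 h1 hq.1) (ih2 h2 hq.2)

/-- If the graphs in `F1` and `F2` live over disjoint sets, taking unions is injective on
`F1 × F2`, because each graph is recovered by restriction. -/
theorem injOn_union_of_disjoint {D1 D2 : Finset S} (hD : Disjoint D1 D2)
    {F1 F2 : Finset (Finset (S × T))} (h1 : ∀ g ∈ F1, ∀ p ∈ g, p.1 ∈ D1)
    (h2 : ∀ g ∈ F2, ∀ p ∈ g, p.1 ∈ D2) :
    Set.InjOn (fun q : Finset (S × T) × Finset (S × T) => q.1 ∪ q.2)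
      (F1 ×ˢ F2 : Finset (Finset (S × T) × Finset (S × T))) := by
  rintro ⟨a, b⟩ hab ⟨c, d⟩ hcd h
  simp only [Finset.coe_product, Set.mem_prod, Finset.mem_coe] at hab hcd
  have hdis : ∀ x ∈ D1, x ∉ D2 := fun x hx => Finset.disjoint_left.1 hD hx
  have hmem : ∀ p, (p ∈ a ∨ p ∈ b) ↔ (p ∈ c ∨ p ∈ d) := fun p => by
    simpa using Finset.ext_iff.1 h p
  have ha := h1 a hab.1
  have hb := h2 b hab.2
  have hc := h1 c hcd.1
  have hd := h2 d hcd.2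
  refine Prod.ext (Finset.ext fun p => ?_) (Finset.ext fun p => ?_) <;> grind

/-- For every legal join/union expression `E` (i.e. `[E] ≠ FAIL`), the
semiring evaluation of `E` computes the measure of its semantics:
`eval_M(E) = ∑_{g ∈ [E]} ∏_{(s,t) ∈ g} M s t`. -/
theorem eval_eq_measure_of_legal
    {A : Type*} [CommSemiring A] (M : S → T → A) :
    ∀ (E : JUExpr S T) (F : Finset (Finset (S × T))), E.sem = some F →
      E.eval M = ∑ g ∈ F, ∏ p ∈ g, M p.1 p.2 := by
  intro E
  induction E with
  | empty =>
    intro F h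
    simp only [JUExpr.sem, Option.some.injEq] at h
    subst h
    simp [JUExpr.eval]
  | unit =>
    intro F h
    simp only [JUExpr.sem, Option.some.injEq] at h
    subst h
    simp [JUExpr.eval]
  | single s t =>
    intro F h
    simp only [JUExpr.sem, Option.some.injEq] at h
    subst h
    simp [JUExpr.eval]
  | union e1 e2 ih1 ih2 =>
    intro F h
    obtain ⟨F1, F2, h1, h2, hdis, rfl⟩ := JUExpr.sem_union_eq_some h
    rw [JUExpr.eval, ih1 F1 h1, ih2 F2 h2, Finset.sum_union hdis]
  | join e1 e2 ih1 ih2 =>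
    intro F h
    obtain ⟨F1, F2, h1, h2, hdom, rfl⟩ := JUExpr.sem_join_eq_some h
    have hm1 : ∀ g ∈ F1, ∀ p ∈ g, p.1 ∈ e1.dom := fun _ hg _ hp =>
      JUExpr.fst_mem_dom_of_mem_sem h1 hg hp
    have hm2 : ∀ g ∈ F2, ∀ p ∈ g, p.1 ∈ e2.dom := fun _ hg _ hp =>
      JUExpr.fst_mem_dom_of_mem_sem h2 hg hp
    rw [JUExpr.eval, ih1 F1 h1, ih2 F2 h2, Finset.sum_mul_sum, ← Finset.sum_product',
      Finset.sum_image (injOn_union_of_disjoint hdom hm1 hm2)]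
    refine Finset.sum_congr rfl fun q hq => ?_
    rw [Finset.mem_product] at hq
    refine (Finset.prod_union (Finset.disjoint_left.2 fun p hp1 hp2 => ?_)).symm
    exact Finset.disjoint_left.1 hdom (hm1 _ hq.1 p hp1) (hm2 _ hq.2 p hp2)
end

section
/- Let (T, bag) be a tree decomposition of a simple graph G, rooted at a node r. Let n be a node of T having exactly one child n', and let v be a vertex of G with bag(n) = bag(n') ∪ {v} and v ∉ bag(n'). Then: (a) v ∉ descbag(n'); (b) descbag(n) = descbag(n') ∪ {v}; and (c) for every vertex u with {u,v} an edge of G and u ∈ descbag(n), one has u ∈ bag(n). -/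
/-- A tree decomposition of a simple graph `G` on a tree `T` with bags `bag : N → Set V`:
(1) every vertex is in some bag; (2) both endpoints of every edge are together in some bag;
(3) if `n2` lies on the (unique) path of `T` between `n1` and `n3`, then
`bag n1 ∩ bag n3 ⊆ bag n2`. -/
structure IsTreeDecomp {V N : Type*} (G : SimpleGraph V) (T : SimpleGraph N)
    (bag : N → Set V) : Prop where
  covers_vertices : ∀ v : V, ∃ n : N, v ∈ bag n
  covers_edges : ∀ u v : V, G.Adj u v → ∃ n : N, u ∈ bag n ∧ v ∈ bag n
  path_inter : ∀ n1 n2 n3 : N, ∀ p : T.Walk n1 n3, p.IsPath → n2 ∈ p.support →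
    bag n1 ∩ bag n3 ⊆ bag n2

/-- `n'` is a descendant of `n` (with respect to the root `r`): `n` lies on the (unique) path
of `T` from `r` to `n'`.  In particular every node is a descendant of itself. -/
def IsDesc {N : Type*} (T : SimpleGraph N) (r n n' : N) : Prop :=
  ∃ p : T.Walk r n', p.IsPath ∧ n ∈ p.support

/-- A child of `n` is a neighbor of `n` that is a descendant of `n`. -/
def IsChild {N : Type*} (T : SimpleGraph N) (r n c : N) : Prop :=
  T.Adj n c ∧ IsDesc T r n c

/-- `descbag n`: the union of the bags of all descendants of `n`. -/
def descbag {V N : Type*} (T : SimpleGraph N) (r : N) (bag : N → Set V) (n : N) : Set V :=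
  {v | ∃ n' : N, IsDesc T r n n' ∧ v ∈ bag n'}

open SimpleGraph in
/-- Every descendant of a child `c` of `n` is a descendant of `n`, and the path to it from `n` runs
through `c`. -/
lemma IsChild.exists_isPath_of_isDesc {N : Type*} {T : SimpleGraph N} (hT : T.IsTree)
    {r n c m : N} (hc : IsChild T r n c) (hm : IsDesc T r c m) :
    IsDesc T r n m ∧ ∃ p : T.Walk n m, p.IsPath ∧ c ∈ p.support := by
  obtain ⟨q, hq, hnq⟩ := hc.2
  obtain ⟨p, hp, hcp⟩ := hm
  obtain ⟨p₁, p₂, rfl⟩ := Walk.mem_support_iff_exists_append.mp hcp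
  obtain rfl : q = p₁ := (hT.existsUnique_path r c).unique hq hp.of_append_left
  obtain ⟨a, b, rfl⟩ := Walk.mem_support_iff_exists_append.mp hnq
  refine ⟨⟨_, hp, by simp [Walk.mem_support_append_iff]⟩, b.append p₂, ?_,
    by simp [Walk.mem_support_append_iff]⟩
  rw [← Walk.append_assoc] at hp
  exact hp.of_append_right

lemma IsDesc.refl_of_isDesc {N : Type*} {T : SimpleGraph N} {r n m : N}
    (h : IsDesc T r n m) : IsDesc T r n n := by
  classical
  obtain ⟨p, hp, hn⟩ := h
  exact ⟨p.takeUntil n hn, hp.takeUntil hn, SimpleGraph.Walk.end_mem_support _⟩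

open SimpleGraph in
lemma IsDesc.eq_or_exists_isChild {N : Type*} {T : SimpleGraph N} {r n m : N}
    (h : IsDesc T r n m) : m = n ∨ ∃ c, IsChild T r n c ∧ IsDesc T r c m := by
  obtain ⟨p, hp, hn⟩ := h
  obtain ⟨a, b, rfl⟩ := Walk.mem_support_iff_exists_append.mp hn
  cases b with
  | nil => exact .inl rfl
  | @cons _ c _ hadj b =>
    refine .inr ⟨c, ⟨hadj, a.concat hadj, ?_, by simp [Walk.support_concat]⟩, _, hp,
      by simp [Walk.mem_support_append_iff]⟩
    rw [← Walk.concat_append] at hp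
    exact hp.of_append_left

open SimpleGraph in
lemma IsDesc.of_adj {N : Type*} {T : SimpleGraph N} (hT : T.IsTree) {r x m k : N}
    (h : IsDesc T r x m) (hadj : T.Adj m k) (hne : m ≠ x) : IsDesc T r x k := by
  obtain ⟨p, hp, hx⟩ := h
  obtain ⟨q, hq, -⟩ := hT.existsUnique_path r k
  refine ⟨q, hq, ?_⟩
  by_cases hm : m ∈ q.support
  · rw [hT.isAcyclic.path_concat hp hq hadj hm]
    simp [Walk.support_concat, hx]
  · have hpq : p = q.concat hadj.symm :=
      (hT.existsUnique_path r m).unique hp (hq.concat hm hadj.symm)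
    simpa [hpq, Walk.support_concat, hne.symm] using hx

open SimpleGraph in
/-- A walk leaving the subtree below `x` passes through `x`. -/
lemma IsDesc.mem_support_of_not_isDesc {N : Type*} {T : SimpleGraph N} (hT : T.IsTree)
    {r x m k : N} (h : IsDesc T r x m) (hk : ¬ IsDesc T r x k) (p : T.Walk m k) :
    x ∈ p.support := by
  induction p with
  | nil => exact absurd h hk
  | @cons m _ _ hadj p ih =>
    by_cases hne : m = x
    · simp [hne]
    · simp [ih (h.of_adj hT hadj hne) hk]

/-- Let `(T, bag)` be a tree decomposition of `G` rooted at `r`, let `n` be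
a node having exactly one child `n'`, and `v` a vertex with `bag n = bag n' ∪ {v}` and
`v ∉ bag n'` (an "introduce" node).  Then (a) `v ∉ descbag n'`;
(b) `descbag n = descbag n' ∪ {v}`; (c) every neighbor `u` of `v` in `G` lying in
`descbag n` lies in `bag n`. -/
theorem introduce_node_properties
    {V N : Type*} [Fintype N]
    (G : SimpleGraph V) (T : SimpleGraph N) (bag : N → Set V)
    (hT : T.IsTree) (hdec : IsTreeDecomp G T bag) (r : N)
    (n n' : N) (hchild : IsChild T r n n')
    (honly : ∀ c : N, IsChild T r n c → c = n')
    (v : V) (hbag : bag n = bag n' ∪ {v}) (hv : v ∉ bag n') :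
    v ∉ descbag T r bag n' ∧
    descbag T r bag n = descbag T r bag n' ∪ {v} ∧
    (∀ u : V, G.Adj u v → u ∈ descbag T r bag n → u ∈ bag n) := by
  have ha : v ∉ descbag T r bag n' := by
    rintro ⟨m, hm, hvm⟩
    obtain ⟨-, p, hp, hn'⟩ := hchild.exists_isPath_of_isDesc hT hm
    exact hv (hdec.path_inter n n' m p hp hn' ⟨by simp [hbag], hvm⟩)
  have hb : descbag T r bag n = descbag T r bag n' ∪ {v} := by
    ext u
    constructor
    · rintro ⟨m, hm, hum⟩
      obtain rfl | ⟨c, hc, hcm⟩ := hm.eq_or_exists_isChild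
      · rw [hbag] at hum
        obtain ⟨p, hp, -⟩ := hchild.2
        exact hum.imp (fun hu => ⟨n', ⟨p, hp, p.end_mem_support⟩, hu⟩) id
      · obtain rfl := honly c hc
        exact .inl ⟨m, hcm, hum⟩
    · rintro (⟨m, hm, hum⟩ | rfl)
      · exact ⟨m, (hchild.exists_isPath_of_isDesc hT hm).1, hum⟩
      · exact ⟨n, hchild.2.refl_of_isDesc, by simp [hbag]⟩
  refine ⟨ha, hb, fun u huv hu => ?_⟩
  rw [hb] at hu
  obtain ⟨m, hm, hum⟩ | rfl := hu
  · obtain ⟨k, huk, hvk⟩ := hdec.covers_edges u v huv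
    obtain ⟨p, hp, -⟩ := hT.existsUnique_path m k
    have hn' := hm.mem_support_of_not_isDesc hT (fun hk => ha ⟨k, hk, hvk⟩) p
    rw [hbag]
    exact .inl (hdec.path_inter m n' k p hp hn' ⟨hum, huk⟩)
  · exact absurd huv (G.irrefl)
end
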